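/- Suppose α, β > 0, α(‖P‖ + β‖H‖²) < 1, and ρ ∈ (0, 2), and let (z^j, w^j, ξ^j, η^j) be the xPIPG iterates from arbitrary initial points ξ¹ ∈ ℝ^n, η¹ ∈ ℝ^m. Then the limit w̄ := lim_{j→∞} (w^{j+1} − w^j) exists, belongs to K°, and satisfies inf_{z∈D} ⟨Hz − g, w̄⟩ = sup_{y∈K} ⟨y, w̄⟩ + (1/(ρβ))‖w̄‖². -/

import Mathlib

open scoped RealInnerProductSpace
open Filter Topology Matrix

/-- Spectral norm (largest singular value) of a real matrix. -/
noncomputable def specNorm {ι κ : Type*} [Fintype ι] [Fintype κ] [DecidableEq κ]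
    (A : Matrix ι κ ℝ) : ℝ :=
  ‖LinearMap.toContinuousLinearMap (Matrix.toEuclideanLin A)‖

/-- The linear map on Euclidean space induced by a matrix (matrix-vector product). -/
noncomputable def mvec {ι κ : Type*} [Fintype ι] [Fintype κ] [DecidableEq κ]
    (A : Matrix ι κ ℝ) (x : EuclideanSpace ℝ κ) : EuclideanSpace ℝ ι :=
  Matrix.toEuclideanLin A x

open Classical in
/-- Projection onto a (nonempty closed convex) set: the minimizer of the distance to `x`. -/
noncomputable def proj {ι : Type*} [Fintype ι] (C : Set (EuclideanSpace ℝ ι))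
    (x : EuclideanSpace ℝ ι) : EuclideanSpace ℝ ι :=
  if h : ∃ y ∈ C, ∀ c ∈ C, ‖x - y‖ ≤ ‖x - c‖ then h.choose else x

/-- Polar cone `K° = {w | ⟨w, y⟩ ≤ 0 for all y ∈ K}`. -/
def polarCone {ι : Type*} [Fintype ι] (K : Set (EuclideanSpace ℝ ι)) :
    Set (EuclideanSpace ℝ ι) := {w | ∀ y ∈ K, ⟪w, y⟫ ≤ 0}

/-- Recession cone `rec D = {y | y + z ∈ D for all z ∈ D}`. -/
def recCone {ι : Type*} [Fintype ι] (D : Set (EuclideanSpace ℝ ι)) :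
    Set (EuclideanSpace ℝ ι) := {y | ∀ z ∈ D, y + z ∈ D}

/-- Normal cone of `C` at `x`: `N_C(x) = {y | ⟨y, x' − x⟩ ≤ 0 for all x' ∈ C}`. -/
def normalCone {ι : Type*} [Fintype ι] (C : Set (EuclideanSpace ℝ ι))
    (x : EuclideanSpace ℝ ι) : Set (EuclideanSpace ℝ ι) :=
  {y | ∀ x' ∈ C, ⟪y, x' - x⟫ ≤ 0}

/-- A closed convex cone. -/
def IsClosedConvexCone {ι : Type*} [Fintype ι] (K : Set (EuclideanSpace ℝ ι)) : Prop :=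
  IsClosed K ∧ Convex ℝ K ∧ ∀ w ∈ K, ∀ c : ℝ, 0 ≤ c → c • w ∈ K

/-- Support function of `D`, valued in `EReal`: `σ_D(x) = sup_{y ∈ D} ⟨y, x⟩`. -/
noncomputable def supportF {ι : Type*} [Fintype ι] (D : Set (EuclideanSpace ℝ ι))
    (x : EuclideanSpace ℝ ι) : EReal :=
  ⨆ y : D, ((⟪(y : EuclideanSpace ℝ ι), x⟫ : ℝ) : EReal)

section Displacement

variable {V : Type*} [NormedAddCommGroup V] [InnerProductSpace ℝ V]

/-- A Kohlberg–Neyman functional: a nonexpansive orbit with escape rate at least `d` escapes at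
rate at least `d` in some fixed direction. -/
theorem exists_escape_direction [FiniteDimensional ℝ V] (x : ℕ → V) (d : ℝ)
    (hx : ∀ n m, ‖x (n + 1) - x (m + 1)‖ ≤ ‖x n - x m‖)
    (hd : ∀ k : ℕ, k * d ≤ ‖x k - x 0‖) :
    ∃ f : V, ‖f‖ ≤ 1 ∧ ∀ k : ℕ, k * d ≤ ⟪f, x k - x 0⟫ := by
  have hshift : ∀ k n m, ‖x (n + k) - x (m + k)‖ ≤ ‖x n - x m‖ := by
    intro k
    induction k with
    | zero => simp
    | succ k ih => exact fun n m => (hx (n + k) (m + k)).trans (ih n m)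
  have approx : ∀ N : ℕ, ∃ f : V, ‖f‖ ≤ 1 ∧
      ∀ k ≤ N, k * (d - 1 / ((N : ℝ) + 1)) ≤ ⟪f, x k - x 0⟫ := by
    intro N
    set ε : ℝ := 1 / ((N : ℝ) + 1) with hε
    have hε0 : 0 < ε := by positivity
    have hlim : Tendsto (fun k : ℕ => ‖x k - x 0‖ - k * (d - ε)) atTop atTop := by
      refine tendsto_atTop_mono (f := fun k : ℕ => (k : ℝ) * ε) (fun k => ?_)
        (tendsto_natCast_atTop_atTop.atTop_mul_const hε0)
      nlinarith [hd k]
    obtain ⟨n, hn, hrec⟩ := high_scores hlim N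
    refine ⟨‖x n - x 0‖⁻¹ • (x n - x 0), ?_, fun k hk => ?_⟩
    · rw [norm_smul, norm_inv, norm_norm]
      exact inv_mul_le_one
    · have hf : ‖‖x n - x 0‖⁻¹ • (x n - x 0)‖ ≤ 1 := by
        rw [norm_smul, norm_inv, norm_norm]
        exact inv_mul_le_one
      have hself : ⟪‖x n - x 0‖⁻¹ • (x n - x 0), x n - x 0⟫ = ‖x n - x 0‖ := by
        rw [real_inner_smul_left, real_inner_self_eq_norm_mul_norm]
        by_cases h0 : ‖x n - x 0‖ = 0
        · simp [h0]
        · field_simp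
      set f := ‖x n - x 0‖⁻¹ • (x n - x 0)
      have h1 : ⟪f, x n - x k⟫ ≤ ‖x n - x k‖ :=
        (real_inner_le_norm _ _).trans (mul_le_of_le_one_left (norm_nonneg _) hf)
      have hkn : k ≤ n := hk.trans hn
      have h2 : ‖x n - x k‖ ≤ ‖x (n - k) - x 0‖ := by
        simpa [Nat.sub_add_cancel hkn] using hshift k (n - k) 0
      have h3 : ‖x (n - k) - x 0‖ ≤ ‖x n - x 0‖ - k * (d - ε) := by
        rcases Nat.eq_zero_or_pos k with rfl | hk0
        · simp
        · have := (hrec (n - k) (by omega)).le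
          rw [Nat.cast_sub hkn] at this
          linarith
      have h4 : ⟪f, x k - x 0⟫ = ⟪f, x n - x 0⟫ - ⟪f, x n - x k⟫ := by
        rw [← inner_sub_right]
        congr 1
        abel
      linarith
  choose f hf1 hf2 using approx
  obtain ⟨a, ha, φ, hφ, hlim⟩ := (isCompact_closedBall (0 : V) 1).tendsto_subseq
    (x := f) (fun n => by simpa using hf1 n)
  refine ⟨a, by simpa using ha, fun k => ?_⟩
  have hL : Tendsto (fun i => (k : ℝ) * (d - 1 / ((φ i : ℝ) + 1))) atTop (𝓝 (k * (d - 0))) :=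
    ((tendsto_one_div_add_atTop_nhds_zero_nat.comp hφ.tendsto_atTop).const_sub d).const_mul _
  have hR : Tendsto (fun i => ⟪f (φ i), x k - x 0⟫) atTop (𝓝 ⟪a, x k - x 0⟫) :=
    hlim.inner tendsto_const_nhds
  rw [sub_zero] at hL
  refine le_of_tendsto_of_tendsto hL hR ?_
  filter_upwards [hφ.tendsto_atTop.eventually_ge_atTop k] with i hi
  exact hf2 (φ i) k hi

theorem tendsto_of_inner_ge_of_norm {ι : Type*} {l : Filter ι} {y : ι → V} {b : ι → ℝ} {v : V}
    {d : ℝ} (hv : ‖v‖ ≤ d) (hyv : ∀ᶠ i in l, d ^ 2 ≤ ⟪v, y i⟫)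
    (hyb : ∀ i, ‖y i‖ ≤ b i) (hb : Tendsto b l (𝓝 d)) : Tendsto y l (𝓝 v) := by
  rw [tendsto_iff_norm_sub_tendsto_zero]
  have h0 : Tendsto (fun i => √(b i ^ 2 - d ^ 2)) l (𝓝 0) := by
    have := ((hb.pow 2).sub_const (d ^ 2)).sqrt
    simpa using this
  refine squeeze_zero' (Eventually.of_forall fun _ => norm_nonneg _) ?_ h0
  filter_upwards [hyv] with i hi
  apply Real.le_sqrt_of_sq_le
  rw [norm_sub_sq_real, real_inner_comm]
  have h1 : ‖y i‖ ^ 2 ≤ b i ^ 2 := pow_le_pow_left₀ (norm_nonneg _) (hyb i) 2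
  have h2 : ‖v‖ ^ 2 ≤ d ^ 2 := pow_le_pow_left₀ (norm_nonneg _) hv 2
  linarith

/-- The displacements of an orbit of an averaged operator converge (Baillon–Bruck–Reich). -/
theorem exists_tendsto_displacement [FiniteDimensional ℝ V] (x : ℕ → V) (c : ℝ) (hc : 0 < c)
    (hx : ∀ n m, ‖x (n + 1) - x (m + 1)‖ ^ 2 ≤
      ‖x n - x m‖ ^ 2 - c * ‖(x (n + 1) - x n) - (x (m + 1) - x m)‖ ^ 2) :
    ∃ v : V, Tendsto (fun n => x (n + 1) - x n) atTop (𝓝 v) := by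
  have hne : ∀ n m, ‖x (n + 1) - x (m + 1)‖ ≤ ‖x n - x m‖ := fun n m => by
    refine le_of_sq_le_sq ?_ (norm_nonneg _)
    nlinarith [hx n m, mul_nonneg hc.le (sq_nonneg ‖(x (n + 1) - x n) - (x (m + 1) - x m)‖)]
  have hshift : ∀ k n m, ‖x (n + k) - x (m + k)‖ ≤ ‖x n - x m‖ := by
    intro k
    induction k with
    | zero => simp
    | succ k ih => exact fun n m => (hne (n + k) (m + k)).trans (ih n m)
  have hanti : Antitone fun n => ‖x (n + 1) - x n‖ :=
    antitone_nat_of_succ_le fun n => hne (n + 1) n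
  obtain ⟨d, hd⟩ : ∃ d, Tendsto (fun n => ‖x (n + 1) - x n‖) atTop (𝓝 d) :=
    ⟨_, tendsto_atTop_ciInf hanti ⟨0, by rintro _ ⟨n, rfl⟩; exact norm_nonneg _⟩⟩
  have hd0 : 0 ≤ d := ge_of_tendsto' hd fun _ => norm_nonneg _
  have hdd : Tendsto (fun n => (x (n + 1 + 1) - x (n + 1)) - (x (n + 1) - x n)) atTop (𝓝 0) := by
    rw [tendsto_zero_iff_norm_tendsto_zero]
    have h0 : Tendsto (fun n => √((‖x (n + 1) - x n‖ ^ 2 - ‖x (n + 1 + 1) - x (n + 1)‖ ^ 2) / c))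
        atTop (𝓝 0) := by
      have := (((hd.pow 2).sub ((hd.comp (tendsto_add_atTop_nat 1)).pow 2)).div_const c).sqrt
      simpa using this
    refine squeeze_zero (fun _ => norm_nonneg _) (fun n => ?_) h0
    apply Real.le_sqrt_of_sq_le
    rw [le_div_iff₀ hc]
    linarith [hx (n + 1) n]
  have hdk : ∀ k, Tendsto (fun n => (x (n + k + 1) - x (n + k)) - (x (n + 1) - x n))
      atTop (𝓝 0) := by
    intro k
    induction k with
    | zero => simp
    | succ k ih =>
      have := (hdd.comp (tendsto_add_atTop_nat k)).add ih
      simp only [add_zero, Function.comp_def] at this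
      refine this.congr fun n => ?_
      rw [← add_assoc]
      abel
  have hek : ∀ k : ℕ, Tendsto (fun n => (x (n + k) - x n) - (k : ℝ) • (x (n + 1) - x n))
      atTop (𝓝 0) := by
    intro k
    induction k with
    | zero => simp
    | succ k ih =>
      have := ih.add (hdk k)
      rw [add_zero] at this
      refine this.congr fun n => ?_
      rw [← add_assoc]
      push_cast
      module
  have hesc : ∀ n k : ℕ, k * d ≤ ‖x (n + k) - x n‖ := by
    intro n k
    have hl : Tendsto (fun j => (k : ℝ) * ‖x (j + 1) - x j‖
        - ‖(x (j + k) - x j) - (k : ℝ) • (x (j + 1) - x j)‖) atTop (𝓝 (k * d - 0)) :=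
      (hd.const_mul _).sub (by simpa using (hek k).norm)
    rw [sub_zero] at hl
    refine le_of_tendsto hl ?_
    filter_upwards [eventually_ge_atTop n] with j hj
    have h1 : ‖x (j + k) - x j‖ ≤ ‖x (n + k) - x n‖ := by
      have := hshift (j - n) (n + k) n
      rwa [show n + k + (j - n) = j + k by omega, show n + (j - n) = j by omega] at this
    have h2 := norm_sub_norm_le ((k : ℝ) • (x (j + 1) - x j)) (x (j + k) - x j)
    rw [norm_smul, Real.norm_natCast, norm_sub_rev (_ • _)] at h2
    linarith
  have hdir : ∀ n, ∃ f : V, ‖f‖ ≤ 1 ∧ ∀ k : ℕ, k * d ≤ ⟪f, x (n + k) - x n⟫ := fun n =>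
    exists_escape_direction (fun k => x (n + k)) d (fun i j => hne (n + i) (n + j)) (hesc n)
  choose f hf1 hf2 using hdir
  have hfd : ∀ n, ‖d • f n‖ ≤ d := fun n => by
    rw [norm_smul, Real.norm_of_nonneg hd0]
    exact mul_le_of_le_one_right hd0 (hf1 n)
  have hmean : ∀ n, Tendsto (fun k : ℕ => (k : ℝ)⁻¹ • (x (n + k) - x n)) atTop (𝓝 (d • f n)) := by
    intro n
    have hces : Tendsto (fun k : ℕ => (k : ℝ)⁻¹ * ∑ i ∈ Finset.range k, ‖x (n + i + 1) - x (n + i)‖)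
        atTop (𝓝 d) :=
      (hd.comp (tendsto_add_atTop_nat n)).cesaro.congr fun k => by
        simp [add_comm n]
    refine tendsto_of_inner_ge_of_norm (hfd n) ?_ (fun k => ?_) hces
    · filter_upwards [eventually_gt_atTop 0] with k hk
      have hk' : (0 : ℝ) < k := by exact_mod_cast hk
      rw [real_inner_smul_left, real_inner_smul_right, sq]
      refine mul_le_mul_of_nonneg_left ?_ hd0
      rw [← div_eq_inv_mul, le_div_iff₀ hk', mul_comm]
      exact hf2 n k
    · rw [norm_smul, norm_inv, Real.norm_natCast]
      refine mul_le_mul_of_nonneg_left ?_ (by positivity)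
      have := Finset.sum_range_sub (fun i => x (n + i)) k
      simp only [add_zero] at this
      rw [← this]
      exact norm_sum_le _ _
  have hsame : ∀ n, d • f n = d • f 0 := by
    intro n
    have hdiff := (hmean n).sub (hmean 0)
    have hzero : Tendsto (fun k : ℕ => (k : ℝ)⁻¹ • (x (n + k) - x n)
        - (k : ℝ)⁻¹ • (x (0 + k) - x 0)) atTop (𝓝 0) := by
      have hb : Tendsto (fun k : ℕ => (k : ℝ)⁻¹ * (‖x n - x 0‖ + ‖x n - x 0‖)) atTop (𝓝 0) := by
        simpa using (tendsto_inv_atTop_nhds_zero_nat (𝕜 := ℝ)).mul_const (‖x n - x 0‖ + ‖x n - x 0‖)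
      refine squeeze_zero_norm (fun k => ?_) hb
      rw [← smul_sub, norm_smul, norm_inv, Real.norm_natCast]
      refine mul_le_mul_of_nonneg_left ?_ (by positivity)
      rw [show x (n + k) - x n - (x (0 + k) - x 0) = (x (n + k) - x (0 + k)) - (x n - x 0) by abel]
      exact (norm_sub_le _ _).trans (add_le_add (hshift k n 0) le_rfl)
    exact sub_eq_zero.mp (tendsto_nhds_unique hdiff hzero)
  refine ⟨d • f 0, tendsto_of_inner_ge_of_norm (hfd 0) (Eventually.of_forall fun n => ?_)
    (fun n => le_rfl) hd⟩
  rw [← hsame n, real_inner_smul_left, sq]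
  refine mul_le_mul_of_nonneg_left ?_ hd0
  simpa using hf2 n 1

end Displacement

/-- The relaxed proximal point iteration for a firmly nonexpansive map, with respect to an
arbitrary inner product `core` on a finite-dimensional space, has convergent displacements. -/
theorem exists_tendsto_relaxed_displacement {W : Type*} [NormedAddCommGroup W] [NormedSpace ℝ W]
    {V : Type*} [AddCommGroup V] [Module ℝ V] [FiniteDimensional ℝ V]
    (core : InnerProductSpace.Core ℝ V) (u p : ℕ → V) (ρ : ℝ) (hρ0 : 0 < ρ) (hρ2 : ρ < 2)
    (hu : ∀ n, u (n + 1) = (1 - ρ) • u n + ρ • p n)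
    (hfirm : ∀ n m, 0 ≤ core.inner (p n - p m) ((u n - u m) - (p n - p m)))
    (L : V →ₗ[ℝ] W) :
    ∃ v : V, Tendsto (fun n => L (u (n + 1) - u n)) atTop (𝓝 (L v)) := by
  let _ : NormedAddCommGroup V := core.toNormedAddCommGroup
  let _ : InnerProductSpace ℝ V := InnerProductSpace.ofCore core.toCore
  obtain ⟨v, hv⟩ := exists_tendsto_displacement u ((2 - ρ) / ρ) (div_pos (by linarith) hρ0) (by
    intro n m
    have h : 0 ≤ ⟪p n - p m, (u n - u m) - (p n - p m)⟫ := hfirm n m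
    have e1 : u (n + 1) - u (m + 1)
        = (u n - u m) - ρ • ((u n - u m) - (p n - p m)) := by
      rw [hu, hu]; module
    have e2 : u (n + 1) - u n - (u (m + 1) - u m)
        = -(ρ • ((u n - u m) - (p n - p m))) := by
      rw [hu, hu]; module
    rw [e1, e2, norm_neg]
    generalize u n - u m = a at *
    generalize p n - p m = b at *
    have h2 : ⟪a, a - b⟫ = ⟪b, a - b⟫ + ‖a - b‖ ^ 2 := by
      rw [← real_inner_self_eq_norm_sq, ← inner_add_left]; simp
    rw [norm_sub_sq_real, real_inner_smul_right, h2, norm_smul, Real.norm_of_nonneg hρ0.le]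
    have : (2 - ρ) / ρ * (ρ * ‖a - b‖) ^ 2 = (2 - ρ) * ρ * ‖a - b‖ ^ 2 := by
      field_simp
    rw [this]
    nlinarith [mul_nonneg hρ0.le h])
  exact ⟨v, ((LinearMap.continuous_of_finiteDimensional L).tendsto v).comp hv⟩

section PrimalDual

variable {E F : Type*} [NormedAddCommGroup E] [InnerProductSpace ℝ E]
  [NormedAddCommGroup F] [InnerProductSpace ℝ F]

/-- The preconditioning quadratic form of the primal-dual iteration is bounded below. -/
theorem precond_lower_bound (P : E →L[ℝ] E) (H : E →L[ℝ] F) (α : ℝ) {β : ℝ} (hβ : 0 < β)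
    (x : E) (y : F) :
    (1 / α - (‖P‖ + β * ‖H‖ ^ 2)) * ‖x‖ ^ 2 + (β * ‖H‖ * ‖x‖ - ‖y‖) ^ 2 / β
      ≤ α⁻¹ * ⟪x, x⟫ - ⟪P x, x⟫ - 2 * ⟪H x, y⟫ + β⁻¹ * ⟪y, y⟫ := by
  have h1 : ⟪P x, x⟫ ≤ ‖P‖ * ‖x‖ ^ 2 := by
    calc ⟪P x, x⟫ ≤ ‖P x‖ * ‖x‖ := real_inner_le_norm _ _
      _ ≤ ‖P‖ * ‖x‖ * ‖x‖ := by gcongr; exact P.le_opNorm x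
      _ = _ := by ring
  have h2 : ⟪H x, y⟫ ≤ ‖H‖ * ‖x‖ * ‖y‖ :=
    (real_inner_le_norm _ _).trans (by gcongr; exact H.le_opNorm x)
  rw [real_inner_self_eq_norm_sq, real_inner_self_eq_norm_sq]
  have h3 : (β * ‖H‖ * ‖x‖ - ‖y‖) ^ 2 / β
      = β * ‖H‖ ^ 2 * ‖x‖ ^ 2 - 2 * (‖H‖ * ‖x‖ * ‖y‖) + β⁻¹ * ‖y‖ ^ 2 := by
    field_simp
    ring
  rw [h3, one_div]
  linarith

/-- The inner product on `E × F` in which the primal-dual iteration is a proximal point method. -/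
@[reducible]
noncomputable def precondCore (P : E →L[ℝ] E) (H : E →L[ℝ] F) (hPs : ∀ x y, ⟪P x, y⟫ = ⟪x, P y⟫)
    {α β : ℝ} (hα : 0 < α) (hβ : 0 < β) (hstep : α * (‖P‖ + β * ‖H‖ ^ 2) < 1) :
    InnerProductSpace.Core ℝ (E × F) :=
  have hκ : 0 < 1 / α - (‖P‖ + β * ‖H‖ ^ 2) := by
    rw [sub_pos, lt_div_iff₀ hα]; linarith
  have hlow := precond_lower_bound P H α hβ
  { inner := fun u v => α⁻¹ * ⟪u.1, v.1⟫ - ⟪P u.1, v.1⟫ - ⟪H u.1, v.2⟫ - ⟪H v.1, u.2⟫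
      + β⁻¹ * ⟪u.2, v.2⟫
    conj_inner_symm := fun u v => by
      simp only [conj_trivial]
      rw [real_inner_comm v.1 u.1, real_inner_comm v.2 u.2, hPs, real_inner_comm (P u.1)]
      ring
    re_inner_nonneg := fun u => by
      have := hlow u.1 u.2
      have h2 : 0 ≤ (1 / α - (‖P‖ + β * ‖H‖ ^ 2)) * ‖u.1‖ ^ 2
          + (β * ‖H‖ * ‖u.1‖ - ‖u.2‖) ^ 2 / β := by positivity
      simp only [RCLike.re_to_real]
      linarith
    add_left := fun u v t => by
      simp only [Prod.fst_add, Prod.snd_add, map_add, inner_add_left, inner_add_right]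
      ring
    smul_left := fun u v r => by
      simp only [Prod.smul_fst, Prod.smul_snd, map_smul, real_inner_smul_left,
        real_inner_smul_right, conj_trivial]
      ring
    definite := fun u hu => by
      have h := hlow u.1 u.2
      have h1 : 0 ≤ (1 / α - (‖P‖ + β * ‖H‖ ^ 2)) * ‖u.1‖ ^ 2 := by positivity
      have h2 : 0 ≤ (β * ‖H‖ * ‖u.1‖ - ‖u.2‖) ^ 2 / β := by positivity
      have h3 : (1 / α - (‖P‖ + β * ‖H‖ ^ 2)) * ‖u.1‖ ^ 2 = 0 := by linarith
      have h4 : (β * ‖H‖ * ‖u.1‖ - ‖u.2‖) ^ 2 / β = 0 := by linarith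
      have h5 : ‖u.1‖ = 0 := by
        simpa using (mul_eq_zero.mp h3).resolve_left hκ.ne'
      have h6 : ‖u.2‖ = 0 := by simpa [hβ.ne', h5] using h4
      exact Prod.ext (norm_eq_zero.mp h5) (norm_eq_zero.mp h6) }

/-- The relaxed primal-dual iteration for the quadratic program with operators `P`, `H`, with the
projections onto `D` and `C` expressed by their variational inequalities. -/
structure IsPrimalDualOrbit (P : E →L[ℝ] E) (H : E →L[ℝ] F) (Ht : F →L[ℝ] E) (q : E) (g : F)
    (D : Set E) (C : Set F) (α β ρ : ℝ) (ξ z : ℕ → E) (η w : ℕ → F) : Prop where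
  primal_mem : ∀ n, z n ∈ D
  primal_vi : ∀ n, ∀ c ∈ D, ⟪ξ n - α • (P (ξ n) + q + Ht (η n)) - z n, c - z n⟫ ≤ 0
  dual_mem : ∀ n, w n ∈ C
  dual_vi : ∀ n, ∀ c ∈ C, ⟪η n + β • (H ((2 : ℝ) • z n - ξ n) - g) - w n, c - w n⟫ ≤ 0
  primal_relax : ∀ n, ξ (n + 1) = (1 - ρ) • ξ n + ρ • z n
  dual_relax : ∀ n, η (n + 1) = (1 - ρ) • η n + ρ • w n

variable {P : E →L[ℝ] E} {H : E →L[ℝ] F} {Ht : F →L[ℝ] E} {q : E} {g : F}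
  {D : Set E} {C : Set F} {α β ρ : ℝ} {ξ z : ℕ → E} {η w : ℕ → F}

theorem IsPrimalDualOrbit.firm (h : IsPrimalDualOrbit P H Ht q g D C α β ρ ξ z η w)
    (hPs : ∀ x y, ⟪P x, y⟫ = ⟪x, P y⟫) (hP0 : ∀ x, 0 ≤ ⟪P x, x⟫)
    (hHt : ∀ x y, ⟪Ht y, x⟫ = ⟪H x, y⟫)
    (hα : 0 < α) (hβ : 0 < β) (hstep : α * (‖P‖ + β * ‖H‖ ^ 2) < 1) (n m : ℕ) :
    0 ≤ (precondCore P H hPs hα hβ hstep).inner ((z n, w n) - (z m, w m))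
      (((ξ n, η n) - (ξ m, η m)) - ((z n, w n) - (z m, w m))) := by
  change 0 ≤ α⁻¹ * ⟪z n - z m, (ξ n - ξ m) - (z n - z m)⟫
    - ⟪P (z n - z m), (ξ n - ξ m) - (z n - z m)⟫
    - ⟪H (z n - z m), (η n - η m) - (w n - w m)⟫
    - ⟪H ((ξ n - ξ m) - (z n - z m)), w n - w m⟫
    + β⁻¹ * ⟪w n - w m, (η n - η m) - (w n - w m)⟫
  have hz : 0 ≤ ⟪(ξ n - ξ m) - (z n - z m) - α • (P (ξ n - ξ m) + Ht (η n - η m)), z n - z m⟫ := by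
    have h1 := h.primal_vi n _ (h.primal_mem m)
    have h2 := h.primal_vi m _ (h.primal_mem n)
    rw [← neg_sub (z n) (z m), inner_neg_right] at h1
    have : (ξ n - ξ m) - (z n - z m) - α • (P (ξ n - ξ m) + Ht (η n - η m))
        = (ξ n - α • (P (ξ n) + q + Ht (η n)) - z n)
          - (ξ m - α • (P (ξ m) + q + Ht (η m)) - z m) := by
      rw [map_sub, map_sub]; module
    rw [this, inner_sub_left]
    linarith
  have hw : 0 ≤ ⟪(η n - η m) - (w n - w m)
      + β • (H (z n - z m) - H ((ξ n - ξ m) - (z n - z m))), w n - w m⟫ := by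
    have h1 := h.dual_vi n _ (h.dual_mem m)
    have h2 := h.dual_vi m _ (h.dual_mem n)
    rw [← neg_sub (w n) (w m), inner_neg_right] at h1
    have : (η n - η m) - (w n - w m) + β • (H (z n - z m) - H ((ξ n - ξ m) - (z n - z m)))
        = (η n + β • (H ((2 : ℝ) • z n - ξ n) - g) - w n)
          - (η m + β • (H ((2 : ℝ) • z m - ξ m) - g) - w m) := by
      simp only [map_sub, map_smul]; module
    rw [this, inner_sub_left]
    linarith
  have hP := hP0 (z n - z m)
  generalize ξ n - ξ m = a at *
  generalize z n - z m = b at *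
  generalize η n - η m = c at *
  generalize w n - w m = d at *
  rw [inner_sub_left, real_inner_smul_left, inner_add_left, hHt] at hz
  rw [inner_add_left, real_inner_smul_left, inner_sub_left (H b)] at hw
  have hz' : 0 ≤ α⁻¹ * ⟪a - b, b⟫ - (⟪P a, b⟫ + ⟪H b, c⟫) := by
    have := mul_nonneg (inv_pos.mpr hα).le hz
    rwa [mul_sub, inv_mul_cancel_left₀ hα.ne'] at this
  have hw' : 0 ≤ β⁻¹ * ⟪c - d, d⟫ + (⟪H b, d⟫ - ⟪H (a - b), d⟫) := by
    have := mul_nonneg (inv_pos.mpr hβ).le hw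
    rwa [mul_add, inv_mul_cancel_left₀ hβ.ne'] at this
  have e1 : ⟪P b, a - b⟫ = ⟪P a, b⟫ - ⟪P b, b⟫ := by
    rw [inner_sub_right, hPs b a, real_inner_comm]
  rw [e1, inner_sub_right (H b), real_inner_comm (a - b) b, real_inner_comm (c - d) d]
  linarith

theorem IsPrimalDualOrbit.exists_tendsto_displacement [FiniteDimensional ℝ E]
    [FiniteDimensional ℝ F] (h : IsPrimalDualOrbit P H Ht q g D C α β ρ ξ z η w)
    (hPs : ∀ x y, ⟪P x, y⟫ = ⟪x, P y⟫) (hP0 : ∀ x, 0 ≤ ⟪P x, x⟫)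
    (hHt : ∀ x y, ⟪Ht y, x⟫ = ⟪H x, y⟫) (hα : 0 < α) (hβ : 0 < β)
    (hstep : α * (‖P‖ + β * ‖H‖ ^ 2) < 1) (hρ0 : 0 < ρ) (hρ2 : ρ < 2) :
    ∃ (r : E) (s : F), Tendsto (fun n => z n - ξ n) atTop (𝓝 r) ∧
      Tendsto (fun n => w n - η n) atTop (𝓝 s) ∧
      Tendsto (fun n => z (n + 1) - z n) atTop (𝓝 (ρ • r)) ∧
      Tendsto (fun n => w (n + 1) - w n) atTop (𝓝 (ρ • s)) := by
  obtain ⟨v, hv⟩ := exists_tendsto_relaxed_displacement (precondCore P H hPs hα hβ hstep)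
    (fun n => (ξ n, η n)) (fun n => (z n, w n)) ρ hρ0 hρ2
    (fun n => Prod.ext (h.primal_relax n) (h.dual_relax n))
    (h.firm hPs hP0 hHt hα hβ hstep) LinearMap.id
  have hres : Tendsto (fun n => (z n - ξ n, w n - η n)) atTop (𝓝 (ρ⁻¹ • v)) := by
    refine (hv.const_smul ρ⁻¹).congr fun n => ?_
    rw [h.primal_relax, h.dual_relax]
    ext
    · change ρ⁻¹ • ((1 - ρ) • ξ n + ρ • z n - ξ n) = z n - ξ n
      rw [show (1 - ρ) • ξ n + ρ • z n - ξ n = ρ • (z n - ξ n) by module,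
        inv_smul_smul₀ hρ0.ne']
    · change ρ⁻¹ • ((1 - ρ) • η n + ρ • w n - η n) = w n - η n
      rw [show (1 - ρ) • η n + ρ • w n - η n = ρ • (w n - η n) by module,
        inv_smul_smul₀ hρ0.ne']
  have hr : Tendsto (fun n => z n - ξ n) atTop (𝓝 (ρ⁻¹ • v).1) :=
    (continuous_fst.tendsto _).comp hres
  have hs : Tendsto (fun n => w n - η n) atTop (𝓝 (ρ⁻¹ • v).2) :=
    (continuous_snd.tendsto _).comp hres
  refine ⟨_, _, hr, hs, ?_, ?_⟩
  · have := ((hr.comp (tendsto_add_atTop_nat 1)).sub hr).add (hr.const_smul ρ)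
    rw [sub_self, zero_add] at this
    refine this.congr fun n => ?_
    simp only [Function.comp_apply, h.primal_relax]
    module
  · have := ((hs.comp (tendsto_add_atTop_nat 1)).sub hs).add (hs.const_smul ρ)
    rw [sub_self, zero_add] at this
    refine this.congr fun n => ?_
    simp only [Function.comp_apply, h.dual_relax]
    module

theorem tendsto_inv_smul_of_tendsto_sub {x : ℕ → E} {v : E} (hρ : ρ ≠ 0)
    (h : Tendsto (fun n => x (n + 1) - x n) atTop (𝓝 (ρ • v))) :
    Tendsto (fun n : ℕ => (ρ⁻¹ * (n : ℝ)⁻¹) • x n) atTop (𝓝 v) := by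
  have h1 := (h.cesaro_smul.add
    ((tendsto_inv_atTop_nhds_zero_nat (𝕜 := ℝ)).smul_const (x 0))).const_smul ρ⁻¹
  rw [zero_smul, add_zero, inv_smul_smul₀ hρ] at h1
  refine h1.congr fun n => ?_
  rw [Finset.sum_range_sub, ← smul_add, sub_add_cancel, mul_smul]

theorem eq_zero_of_inner_self_eq_zero (hPs : ∀ x y, ⟪P x, y⟫ = ⟪x, P y⟫)
    (hP0 : ∀ x, 0 ≤ ⟪P x, x⟫) {x : E} (hx : ⟪P x, x⟫ = 0) : P x = 0 := by
  by_contra hne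
  have hpos : 0 < ‖P x‖ ^ 2 := by positivity
  set c := ⟪P (P x), P x⟫ with hc
  have hc0 : 0 ≤ c := hP0 _
  have key : ∀ t : ℝ, 0 ≤ 2 * t * ‖P x‖ ^ 2 + t ^ 2 * c := fun t => by
    have := hP0 (x + t • P x)
    rw [map_add, map_smul, inner_add_left, inner_add_right, inner_add_right, hx,
      real_inner_smul_left, real_inner_smul_left, real_inner_smul_right, real_inner_smul_right,
      hPs (P x) x, real_inner_self_eq_norm_sq] at this
    linarith
  have h1 := key (-(‖P x‖ ^ 2 / (c + 1)))
  have h2 : 2 * -(‖P x‖ ^ 2 / (c + 1)) * ‖P x‖ ^ 2 + (-(‖P x‖ ^ 2 / (c + 1))) ^ 2 * c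
      = -((‖P x‖ ^ 2) ^ 2 * (c + 2) / (c + 1) ^ 2) := by
    field_simp
    ring
  rw [h2] at h1
  have : 0 < (‖P x‖ ^ 2) ^ 2 * (c + 2) / (c + 1) ^ 2 := by positivity
  linarith

/-- The limiting dual displacement separates the set of all `H x - g`, `x ∈ D`, from the polar of
`C`, with a gap that is attained in the limit along the orbit. -/
theorem IsPrimalDualOrbit.separation
    (h : IsPrimalDualOrbit P H Ht q g D C α β ρ ξ z η w)
    (hPs : ∀ x y, ⟪P x, y⟫ = ⟪x, P y⟫) (hP0 : ∀ x, 0 ≤ ⟪P x, x⟫)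
    (hHt : ∀ x y, ⟪Ht y, x⟫ = ⟪H x, y⟫) (hα : 0 < α) (hβ : 0 < β) (hρ : 0 < ρ)
    (hCcl : IsClosed C) (hCadd : ∀ x ∈ C, ∀ y ∈ C, x + y ∈ C)
    (hCsmul : ∀ x ∈ C, ∀ t : ℝ, 0 ≤ t → t • x ∈ C) {r : E} {s : F}
    (hr : Tendsto (fun n => z n - ξ n) atTop (𝓝 r))
    (hs : Tendsto (fun n => w n - η n) atTop (𝓝 s))
    (hz : Tendsto (fun n => z (n + 1) - z n) atTop (𝓝 (ρ • r)))
    (hw : Tendsto (fun n => w (n + 1) - w n) atTop (𝓝 (ρ • s))) :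
    s ∈ C ∧ (∀ x ∈ D, ‖s‖ ^ 2 / β ≤ ⟪H x - g, s⟫) ∧
      ∃ b : ℕ → ℝ, (∀ n, ⟪H (z n) - g, s⟫ ≤ b n) ∧ Tendsto b atTop (𝓝 (‖s‖ ^ 2 / β)) := by
  let t : ℕ → ℝ := fun n => ρ⁻¹ * (n : ℝ)⁻¹
  have ht : Tendsto t atTop (𝓝 0) := by
    simpa using (tendsto_inv_atTop_nhds_zero_nat (𝕜 := ℝ)).const_mul ρ⁻¹
  have ht0 : ∀ n, 0 ≤ t n := fun n => by positivity
  have htz : Tendsto (fun n => t n • z n) atTop (𝓝 r) :=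
    tendsto_inv_smul_of_tendsto_sub hρ.ne' hz
  have htw : Tendsto (fun n => t n • w n) atTop (𝓝 s) :=
    tendsto_inv_smul_of_tendsto_sub hρ.ne' hw
  have htξ : Tendsto (fun n => t n • ξ n) atTop (𝓝 r) := by
    simpa [smul_sub] using htz.sub (ht.smul hr)
  have htη : Tendsto (fun n => t n • η n) atTop (𝓝 s) := by
    simpa [smul_sub] using htw.sub (ht.smul hs)
  have hPc : ∀ {x : ℕ → E} {v : E}, Tendsto x atTop (𝓝 v) →
      Tendsto (fun n => P (x n)) atTop (𝓝 (P v)) := fun hx => (P.continuous.tendsto _).comp hx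
  have hHc : ∀ {x : ℕ → E} {v : E}, Tendsto x atTop (𝓝 v) →
      Tendsto (fun n => H (x n)) atTop (𝓝 (H v)) := fun hx => (H.continuous.tendsto _).comp hx
  have hHtc : ∀ {x : ℕ → F} {v : F}, Tendsto x atTop (𝓝 v) →
      Tendsto (fun n => Ht (x n)) atTop (𝓝 (Ht v)) := fun hx => (Ht.continuous.tendsto _).comp hx
  have hsC : s ∈ C := hCcl.mem_of_tendsto htw
    (Eventually.of_forall fun n => hCsmul _ (h.dual_mem n) _ (ht0 n))
  have hC0 : (0 : F) ∈ C := by simpa using hCsmul s hsC 0 le_rfl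
  -- normal vectors of `D` and `C` produced by the iteration
  let a : ℕ → E := fun n => ξ n - α • (P (ξ n) + q + Ht (η n)) - z n
  let b : ℕ → F := fun n => η n + β • (H ((2 : ℝ) • z n - ξ n) - g) - w n
  have ha : ∀ n, a n = -(z n - ξ n) - α • (P (ξ n) + q + Ht (η n)) := fun n => by
    simp only [a]; abel
  have hb : ∀ n, b n = -(w n - η n) + β • (H (z n) + H (z n - ξ n) - g) := fun n => by
    simp only [b]
    rw [← map_add, show z n + (z n - ξ n) = (2 : ℝ) • z n - ξ n by module]
    abel
  have haD : ∀ n, ∀ c ∈ D, ⟪a n, c - z n⟫ ≤ 0 := h.primal_vi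
  have hbC : ∀ n, ∀ y ∈ C, ⟪b n, y⟫ ≤ 0 := fun n y hy => by
    have := h.dual_vi n (w n + y) (hCadd _ (h.dual_mem n) _ hy)
    rwa [add_sub_cancel_left] at this
  have hbw : ∀ n, ⟪b n, w n⟫ = 0 := fun n => by
    refine le_antisymm (hbC n _ (h.dual_mem n)) ?_
    have := h.dual_vi n 0 hC0
    rw [zero_sub, inner_neg_right] at this
    linarith
  have hta : Tendsto (fun n => t n • a n) atTop (𝓝 (-(α • (P r + Ht s)))) := by
    have := (ht.smul hr).neg.sub
      ((((hPc htξ).add (ht.smul_const q)).add (hHtc htη)).const_smul α)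
    simp only [zero_smul, neg_zero, zero_sub, add_zero] at this
    refine this.congr fun n => ?_
    rw [ha, map_smul, map_smul]
    module
  have htb : Tendsto (fun n => t n • b n) atTop (𝓝 (β • H r)) := by
    have := (ht.smul hs).neg.add
      ((((hHc htz).add (ht.smul (hHc hr))).sub (ht.smul_const g)).const_smul β)
    simp only [zero_smul, neg_zero, zero_add, add_zero, sub_zero] at this
    refine this.congr fun n => ?_
    rw [hb, map_smul]
    module
  have hHrC : ∀ y ∈ C, ⟪H r, y⟫ ≤ 0 := fun y hy => by
    have h1 : ⟪β • H r, y⟫ ≤ 0 := le_of_tendsto' (htb.inner tendsto_const_nhds) fun n => by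
      rw [real_inner_smul_left]
      exact mul_nonpos_of_nonneg_of_nonpos (ht0 n) (hbC n y hy)
    rw [real_inner_smul_left] at h1
    exact nonpos_of_mul_nonpos_right h1 hβ
  have hHrs : ⟪H r, s⟫ = 0 := by
    have h1 : ⟪β • H r, s⟫ = 0 := tendsto_nhds_unique (htb.inner htw) <|
      tendsto_const_nhds.congr fun n => by
        rw [real_inner_smul_left, real_inner_smul_right, hbw]; simp
    rw [real_inner_smul_left] at h1
    exact (mul_eq_zero.mp h1).resolve_left hβ.ne'
  have hPr : P r = 0 := by
    obtain ⟨x, hx⟩ : ∃ x, x ∈ D := ⟨z 0, h.primal_mem 0⟩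
    have hlim : Tendsto (fun n => ⟪t n • a n, t n • (x - z n)⟫) atTop
        (𝓝 ⟪-(α • (P r + Ht s)), (0 : ℝ) • x - r⟫) := by
      refine hta.inner (((ht.smul_const x).sub htz).congr fun n => ?_)
      rw [smul_sub]
    have h1 : ⟪-(α • (P r + Ht s)), (0 : ℝ) • x - r⟫ ≤ 0 := le_of_tendsto' hlim fun n => by
      rw [real_inner_smul_left, real_inner_smul_right]
      exact mul_nonpos_of_nonneg_of_nonpos (ht0 n)
        (mul_nonpos_of_nonneg_of_nonpos (ht0 n) (haD n x hx))
    rw [zero_smul, zero_sub, inner_neg_neg, real_inner_smul_left, inner_add_left, hHt, hHrs,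
      add_zero] at h1
    exact eq_zero_of_inner_self_eq_zero hPs hP0
      (le_antisymm (nonpos_of_mul_nonpos_right h1 hα) (hP0 r))
  have har : ∀ n, ⟪a n, r⟫ ≤ 0 := fun n => by
    have hlim : Tendsto (fun k => ⟪a n, t k • (z k - z n)⟫) atTop
        (𝓝 ⟪a n, r - (0 : ℝ) • z n⟫) := by
      refine tendsto_const_nhds.inner ((htz.sub (ht.smul_const (z n))).congr fun k => ?_)
      rw [smul_sub]
    have h1 := le_of_tendsto' hlim fun k => by
      rw [real_inner_smul_right]
      exact mul_nonpos_of_nonneg_of_nonpos (ht0 k) (haD n _ (h.primal_mem k))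
    simpa using h1
  have hqr : -⟪r, r⟫ - α * ⟪q, r⟫ ≤ 0 := by
    have hlim : Tendsto (fun n => -⟪z n - ξ n, r⟫ - α * ⟪q, r⟫ + α * ⟪H r, w n - η n⟫) atTop
        (𝓝 (-⟪r, r⟫ - α * ⟪q, r⟫ + α * ⟪H r, s⟫)) :=
      ((hr.inner tendsto_const_nhds).neg.sub_const _).add
        ((tendsto_const_nhds.inner hs).const_mul α)
    rw [hHrs, mul_zero, add_zero] at hlim
    refine le_of_tendsto' hlim fun n => ?_
    have h1 := har n
    rw [ha, inner_sub_left, inner_neg_left, real_inner_smul_left, inner_add_left, inner_add_left,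
      hPs, hPr, inner_zero_right, hHt] at h1
    rw [inner_sub_right]
    nlinarith [mul_nonpos_of_nonneg_of_nonpos hα.le (hHrC _ (h.dual_mem n))]
  refine ⟨hsC, fun x hx => ?_, fun n => (⟪w n - η n, s⟫ - β * ⟪H (z n - ξ n), s⟫) / β,
    fun n => ?_, ?_⟩
  · have hL : Tendsto (fun n => ⟪t n • a n, x⟫) atTop (𝓝 ⟪-(α • (P r + Ht s)), x⟫) :=
      hta.inner tendsto_const_nhds
    have hR : Tendsto (fun n => -⟪z n - ξ n, t n • z n⟫
        - α * (-⟪P (z n - ξ n), t n • z n⟫ + ⟪q, t n • z n⟫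
          + (β⁻¹ * (⟪w n - η n, t n • w n⟫ - β * ⟪H (z n - ξ n), t n • w n⟫
              + β * ⟪g, t n • w n⟫)
            - ⟪H (t n • z n), w n - η n⟫))) atTop
        (𝓝 (-⟪r, r⟫ - α * (-⟪P r, r⟫ + ⟪q, r⟫
          + (β⁻¹ * (⟪s, s⟫ - β * ⟪H r, s⟫ + β * ⟪g, s⟫) - ⟪H r, s⟫)))) := by
      refine (hr.inner htz).neg.sub (Tendsto.const_mul α ?_)
      refine (((hPc hr).inner htz).neg.add (tendsto_const_nhds.inner htz)).add ?_
      refine Tendsto.sub (Tendsto.const_mul _ ?_) ((hHc htz).inner hs)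
      exact ((hs.inner htw).sub (((hHc hr).inner htw).const_mul β)).add
        ((tendsto_const_nhds.inner htw).const_mul β)
    have hle := le_of_tendsto_of_tendsto' hL hR fun n => by
      have h1 := haD n x hx
      rw [inner_sub_right] at h1
      have hw' : ⟪H (z n), w n⟫
          = β⁻¹ * (⟪w n - η n, w n⟫ - β * ⟪H (z n - ξ n), w n⟫ + β * ⟪g, w n⟫) := by
        have h2 := hbw n
        rw [hb, inner_add_left, inner_neg_left, real_inner_smul_left,
          inner_sub_left (H (z n) + _), inner_add_left] at h2
        rw [eq_inv_mul_iff_mul_eq₀ hβ.ne']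
        linarith
      have hz' : ⟪a n, z n⟫ ≤ -⟪z n - ξ n, z n⟫ - α * (-⟪P (z n - ξ n), z n⟫ + ⟪q, z n⟫
          + (⟪H (z n), w n⟫ - ⟪H (z n), w n - η n⟫)) := by
        rw [ha, inner_sub_left, inner_neg_left, real_inner_smul_left, inner_add_left,
          inner_add_left, hHt, map_sub, inner_sub_left (P (z n)), inner_sub_right (H (z n))]
        nlinarith [mul_nonneg hα.le (hP0 (z n))]
      rw [hw'] at hz'
      have h3 := mul_le_mul_of_nonneg_left (h1.trans' (sub_le_sub_left hz' _)) (ht0 n)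
      simp only [map_smul, real_inner_smul_left, real_inner_smul_right]
      linarith
    rw [hPr, hHrs, zero_add, inner_neg_left, real_inner_smul_left, hHt, inner_zero_left] at hle
    rw [inner_sub_left, div_eq_inv_mul, ← real_inner_self_eq_norm_sq]
    have h5 : β⁻¹ * (⟪s, s⟫ - β * 0 + β * ⟪g, s⟫) = β⁻¹ * ⟪s, s⟫ + ⟪g, s⟫ := by
      field_simp
      ring
    rw [h5] at hle
    refine le_of_mul_le_mul_left (a := α) ?_ hα
    linarith
  · have h1 := hbC n s hsC
    rw [hb, inner_add_left, inner_neg_left, real_inner_smul_left,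
      inner_sub_left (H (z n) + _), inner_add_left] at h1
    rw [le_div_iff₀ hβ, inner_sub_left]
    linarith
  · have := ((hs.inner (tendsto_const_nhds (x := s))).sub
      (((hHc hr).inner (tendsto_const_nhds (x := s))).const_mul β)).div_const β
    rwa [hHrs, mul_zero, sub_zero, real_inner_self_eq_norm_sq] at this

end PrimalDual

theorem proj_mem_and_inner_le {ι : Type*} [Fintype ι] {C : Set (EuclideanSpace ℝ ι)}
    (hne : C.Nonempty) (hcl : IsClosed C) (hcv : Convex ℝ C) (x : EuclideanSpace ℝ ι) :
    proj C x ∈ C ∧ ∀ c ∈ C, ⟪x - proj C x, c - proj C x⟫ ≤ 0 := by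
  have : Nonempty C := hne.to_subtype
  have hbdd : BddBelow (Set.range fun c : C => ‖x - c‖) :=
    ⟨0, by rintro _ ⟨c, rfl⟩; exact norm_nonneg _⟩
  have hex : ∃ y ∈ C, ∀ c ∈ C, ‖x - y‖ ≤ ‖x - c‖ := by
    obtain ⟨y, hy, hmin⟩ := exists_norm_eq_iInf_of_complete_convex hne hcl.isComplete hcv x
    exact ⟨y, hy, fun c hc => hmin.trans_le (ciInf_le hbdd ⟨c, hc⟩)⟩
  obtain ⟨hmem, hmin⟩ : proj C x ∈ C ∧ ∀ c ∈ C, ‖x - proj C x‖ ≤ ‖x - c‖ := by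
    rw [proj, dif_pos hex]
    exact hex.choose_spec
  exact ⟨hmem, (norm_eq_iInf_iff_real_inner_le_zero hcv hmem).mp
    (le_antisymm (le_ciInf fun c => hmin c c.2) (ciInf_le hbdd ⟨_, hmem⟩))⟩

theorem isClosed_polarCone {ι : Type*} [Fintype ι] (K : Set (EuclideanSpace ℝ ι)) :
    IsClosed (polarCone K) := by
  have : polarCone K = ⋂ y ∈ K, {w | ⟪w, y⟫ ≤ 0} := by
    ext w
    simp [polarCone]
  rw [this]
  exact isClosed_biInter fun y _ =>
    isClosed_le (continuous_id.inner continuous_const) continuous_const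

theorem add_mem_polarCone {ι : Type*} [Fintype ι] {K : Set (EuclideanSpace ℝ ι)} :
    ∀ x ∈ polarCone K, ∀ y ∈ polarCone K, x + y ∈ polarCone K := fun x hx y hy k hk => by
  rw [inner_add_left]
  exact add_nonpos (hx k hk) (hy k hk)

theorem smul_mem_polarCone {ι : Type*} [Fintype ι] {K : Set (EuclideanSpace ℝ ι)} :
    ∀ x ∈ polarCone K, ∀ t : ℝ, 0 ≤ t → t • x ∈ polarCone K := fun x hx t ht k hk => by
  rw [real_inner_smul_left]
  exact mul_nonpos_of_nonneg_of_nonpos ht (hx k hk)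

theorem convex_polarCone {ι : Type*} [Fintype ι] (K : Set (EuclideanSpace ℝ ι)) :
    Convex ℝ (polarCone K) := fun _ hx _ hy _ _ ha hb _ =>
  add_mem_polarCone _ (smul_mem_polarCone _ hx _ ha) _ (smul_mem_polarCone _ hy _ hb)

theorem iSup_inner_eq_zero_of_mem_polarCone {ι : Type*} [Fintype ι]
    {K : Set (EuclideanSpace ℝ ι)} (h0 : (0 : EuclideanSpace ℝ ι) ∈ K)
    {w : EuclideanSpace ℝ ι} (hw : w ∈ polarCone K) :
    (⨆ y : K, ((⟪(y : EuclideanSpace ℝ ι), w⟫ : ℝ) : EReal)) = 0 := by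
  refine le_antisymm (iSup_le fun y => ?_) (le_iSup_of_le ⟨0, h0⟩ (by simp))
  rw [real_inner_comm]
  exact_mod_cast hw y y.2

theorem inner_mvec_transpose {ι κ : Type*} [Fintype ι] [Fintype κ] [DecidableEq ι]
    [DecidableEq κ] (A : Matrix ι κ ℝ) (x : EuclideanSpace ℝ κ) (y : EuclideanSpace ℝ ι) :
    ⟪mvec Aᵀ y, x⟫ = ⟪mvec A x, y⟫ := by
  rw [mvec, mvec, ← Matrix.conjTranspose_eq_transpose_of_trivial,
    Matrix.toEuclideanLin_conjTranspose_eq_adjoint, LinearMap.adjoint_inner_left, real_inner_comm]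

/-- the separating-hyperplane identity satisfied by the limit
`w̄ = lim (wʲ⁺¹ − wʲ)` of the xPIPG iterates. -/
theorem stmt7 {n m : ℕ} (P : Matrix (Fin n) (Fin n) ℝ) (q : EuclideanSpace ℝ (Fin n))
    (H : Matrix (Fin m) (Fin n) ℝ) (g : EuclideanSpace ℝ (Fin m))
    (D : Set (EuclideanSpace ℝ (Fin n))) (K : Set (EuclideanSpace ℝ (Fin m)))
    (hP : P.PosSemidef)
    (hDne : D.Nonempty) (hDcl : IsClosed D) (hDcv : Convex ℝ D)
    (hKne : K.Nonempty) (hK : IsClosedConvexCone K)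
    (α β ρ : ℝ) (hα : 0 < α) (hβ : 0 < β)
    (hstep : α * (specNorm P + β * specNorm H ^ 2) < 1)
    (hρ : ρ ∈ Set.Ioo (0 : ℝ) 2)
    (z ξ : ℕ → EuclideanSpace ℝ (Fin n)) (w η : ℕ → EuclideanSpace ℝ (Fin m))
    (hz : ∀ j, 1 ≤ j → z (j + 1) = proj D (ξ j - α • (mvec P (ξ j) + q + mvec Hᵀ (η j))))
    (hw : ∀ j, 1 ≤ j → w (j + 1) =
      proj (polarCone K) (η j + β • (mvec H ((2 : ℝ) • z (j + 1) - ξ j) - g)))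
    (hξ : ∀ j, 1 ≤ j → ξ (j + 1) = (1 - ρ) • ξ j + ρ • z (j + 1))
    (hη : ∀ j, 1 ≤ j → η (j + 1) = (1 - ρ) • η j + ρ • w (j + 1)) :
    ∃ wbar : EuclideanSpace ℝ (Fin m),
      Tendsto (fun j : ℕ => w (j + 1) - w j) atTop (𝓝 wbar) ∧ wbar ∈ polarCone K ∧
      (⨅ zD : D, ((⟪mvec H (zD : EuclideanSpace ℝ (Fin n)) - g, wbar⟫ : ℝ) : EReal)) =
        (⨆ y : K, ((⟪(y : EuclideanSpace ℝ (Fin m)), wbar⟫ : ℝ) : EReal)) +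
          ((1 / (ρ * β) * ‖wbar‖ ^ 2 : ℝ) : EReal) := by
  have h0P : (0 : EuclideanSpace ℝ (Fin m)) ∈ polarCone K := fun y _ => by simp
  let P' := LinearMap.toContinuousLinearMap (Matrix.toEuclideanLin P)
  let H' := LinearMap.toContinuousLinearMap (Matrix.toEuclideanLin H)
  let Ht := LinearMap.toContinuousLinearMap (Matrix.toEuclideanLin Hᵀ)
  have hPs : ∀ x y, ⟪P' x, y⟫ = ⟪x, P' y⟫ := fun x y => by
    have hT : Pᵀ = P := by
      rw [← Matrix.conjTranspose_eq_transpose_of_trivial]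
      exact hP.isHermitian
    have := inner_mvec_transpose P y x
    rw [hT] at this
    exact this.trans (real_inner_comm _ _)
  have hP0 : ∀ x, 0 ≤ ⟪P' x, x⟫ := fun x =>
    (Matrix.isPositive_toEuclideanLin_iff.mpr hP).2 x
  have hHt : ∀ x y, ⟪Ht y, x⟫ = ⟪H' x, y⟫ := inner_mvec_transpose H
  have hstep' : α * (‖P'‖ + β * ‖H'‖ ^ 2) < 1 := hstep
  have hprim := proj_mem_and_inner_le hDne hDcl hDcv
  have hdual := proj_mem_and_inner_le ⟨0, h0P⟩ (isClosed_polarCone K) (convex_polarCone K)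
  have orbit : IsPrimalDualOrbit P' H' Ht q g D (polarCone K) α β ρ (fun j => ξ (j + 1))
      (fun j => z (j + 2)) (fun j => η (j + 1)) (fun j => w (j + 2)) :=
    { primal_mem := fun j => by rw [hz (j + 1) (by omega)]; exact (hprim _).1
      primal_vi := fun j => by rw [hz (j + 1) (by omega)]; exact (hprim _).2
      dual_mem := fun j => by rw [hw (j + 1) (by omega)]; exact (hdual _).1
      dual_vi := fun j => by rw [hw (j + 1) (by omega)]; exact (hdual _).2
      primal_relax := fun j => hξ (j + 1) (by omega)
      dual_relax := fun j => hη (j + 1) (by omega) }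
  obtain ⟨r, s, hr, hs, hzlim, hwlim⟩ :=
    orbit.exists_tendsto_displacement hPs hP0 hHt hα hβ hstep' hρ.1 hρ.2
  obtain ⟨hsC, hlow, b, hb, hblim⟩ := orbit.separation hPs hP0 hHt hα hβ hρ.1
    (isClosed_polarCone K) add_mem_polarCone smul_mem_polarCone hr hs hzlim hwlim
  have hmem : ρ • s ∈ polarCone K := smul_mem_polarCone s hsC ρ hρ.1.le
  have hK0 : (0 : EuclideanSpace ℝ (Fin m)) ∈ K := by
    obtain ⟨y, hy⟩ := hKne
    simpa using hK.2.2 y hy 0 le_rfl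
  refine ⟨ρ • s, (tendsto_add_atTop_iff_nat 2).mp (hwlim.congr fun j => ?_), hmem, ?_⟩
  · rw [show j + 1 + 2 = j + 2 + 1 by omega]
  have hgap : 1 / (ρ * β) * ‖ρ • s‖ ^ 2 = ρ * (‖s‖ ^ 2 / β) := by
    have := hρ.1.ne'
    rw [norm_smul, Real.norm_of_nonneg hρ.1.le]
    field_simp
  rw [iSup_inner_eq_zero_of_mem_polarCone hK0 hmem, zero_add, hgap]
  refine le_antisymm ?_ (le_iInf fun x => ?_)
  · refine ge_of_tendsto' (continuous_coe_real_ereal.continuousAt.tendsto.comp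
      (hblim.const_mul ρ)) fun j => iInf_le_of_le ⟨_, orbit.primal_mem j⟩ ?_
    rw [Function.comp_apply, EReal.coe_le_coe_iff, real_inner_smul_right]
    exact mul_le_mul_of_nonneg_left (hb j) hρ.1.le
  · rw [EReal.coe_le_coe_iff, real_inner_smul_right]
    exact mul_le_mul_of_nonneg_left (hlow x x.2) hρ.1.le
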